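/- (Asymptotic completeness bound with half-derivative loss.) Let s ∈ ℝ and let (a_λ, b_λ)_{λ∈ℤ^D\{0}} be real numbers with N := ∑_{λ∈ℤ^D\{0}} ⟨λ⟩^{2s+1}·(a_λ² + b_λ²) < ∞. Then for each λ ∈ ℤ^D \ {0} there is a unique λ-mode wave solution (φ_λ, ψ_λ) on (0,∞) with lim_{t→0⁺} ψ_λ(t) = a_λ and lim_{t→0⁺} (φ_λ(t) − ψ_λ(t)·log(t/t_{λ*})) = b_λ, and these solutions satisfy ∑_{λ∈ℤ^D\{0}} (⟨λ⟩^{2s+2}·φ_λ(1)² + ⟨λ⟩^{2s}·ψ_λ(1)²) ≤ C·N, where C > 0 depends only on D and p_1,…,p_D (in particular not on s). -/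

import Mathlib

open Real Filter MeasureTheory Topology

/-- τ_λ(t) = (∑ᵢ t^(2-2pᵢ) λᵢ²)^(1/2). -/
noncomputable def tau {D : ℕ} (p : Fin D → ℝ) (lam : Fin D → ℤ) (t : ℝ) : ℝ :=
  Real.sqrt (∑ i, t ^ (2 - 2 * p i) * ((lam i : ℝ)) ^ 2)

/-- The Japanese bracket ⟨λ⟩ = (1 + |λ|²)^(1/2) of a frequency λ ∈ ℤ^D. -/
noncomputable def jap {D : ℕ} (lam : Fin D → ℤ) : ℝ :=
  Real.sqrt (1 + ∑ i, ((lam i : ℝ)) ^ 2)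

/-- A λ-mode wave solution on the set `I`: t φ' = ψ and t ψ' = -τ_λ(t)² φ. -/
def IsWaveSol {D : ℕ} (p : Fin D → ℝ) (lam : Fin D → ℤ) (φ ψ : ℝ → ℝ) (I : Set ℝ) : Prop :=
  ∀ t ∈ I, HasDerivAt φ (ψ t / t) t ∧ HasDerivAt ψ (-(tau p lam t ^ 2) * φ t / t) t

/-- Global forward existence for linear ordinary differential equations with continuous
coefficients. -/
theorem exists_forall_hasDerivAt_linear {E : Type*} [NormedAddCommGroup E] [NormedSpace ℝ E]
    [CompleteSpace E] {B : ℝ → E →L[ℝ] E} (hB : Continuous B) (x₀ : E) :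
    ∃ u : ℝ → E, u 0 = x₀ ∧ ∀ s, 0 ≤ s → HasDerivAt u (B s (u s)) s := by
  set G : ℝ → ℝ := fun s => ∫ r in (0:ℝ)..s, ‖B r‖ with hG
  have hGd : ∀ s, HasDerivAt G ‖B s‖ s := fun s =>
    (hB.norm.integral_hasStrictDerivAt 0 s).hasDerivAt
  have hGc : Continuous G := continuous_iff_continuousAt.2 fun s => (hGd s).continuousAt
  have hG0 : G 0 = 0 := by simp [hG]
  have hGpos : ∀ s, 0 ≤ s → 0 ≤ G s := fun s hs =>
    intervalIntegral.integral_nonneg hs fun r _ => norm_nonneg _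
  have hweight : ∀ s, ∫ r in (0:ℝ)..s, exp (2 * G r) * ‖B r‖ = (exp (2 * G s) - 1) / 2 := by
    intro s
    have hd : ∀ r, HasDerivAt (fun r => exp (2 * G r) / 2) (exp (2 * G r) * ‖B r‖) r := by
      intro r
      have := (((hGd r).const_mul 2).exp).div_const 2
      exact this.congr_deriv (by ring)
    rw [intervalIntegral.integral_eq_sub_of_hasDerivAt (fun r _ => hd r)
      (Continuous.intervalIntegrable (by fun_prop) _ _), hG0]
    simp
    ring
  have hFc : ∀ f : BoundedContinuousFunction ℝ E,
      Continuous fun r => exp (2 * G r) • B r (f r) := fun f =>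
    (by fun_prop : Continuous fun r => exp (2 * G r)).smul (hB.clm_apply f.continuous)
  have hest : ∀ f : BoundedContinuousFunction ℝ E, ∀ s, 0 ≤ s →
      ‖∫ r in (0:ℝ)..s, exp (2 * G r) • B r (f r)‖ ≤ (exp (2 * G s) - 1) / 2 * ‖f‖ := by
    intro f s hs
    rw [← hweight s, ← intervalIntegral.integral_mul_const]
    refine intervalIntegral.norm_integral_le_of_norm_le hs (Eventually.of_forall fun r _ => ?_)
      (Continuous.intervalIntegrable (by fun_prop) _ _)
    rw [norm_smul, norm_of_nonneg (exp_pos _).le, mul_assoc]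
    gcongr
    exact (B r).le_of_opNorm_le_of_le le_rfl (f.norm_coe_le_norm r)
  have hone : ∀ s, 0 ≤ s → exp (-(2 * G s)) ≤ 1 := fun s hs => by
    rw [exp_le_one_iff]; linarith [hGpos s hs]
  have hmul : ∀ s, exp (-(2 * G s)) * exp (2 * G s) = 1 := fun s => by
    rw [← exp_add]; simp
  have hhalf : ∀ f : BoundedContinuousFunction ℝ E, ∀ s, 0 ≤ s →
      ‖exp (-(2 * G s)) • ∫ r in (0:ℝ)..s, exp (2 * G r) • B r (f r)‖ ≤ 1 / 2 * ‖f‖ := by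
    intro f s hs
    rw [norm_smul, norm_of_nonneg (exp_pos _).le]
    calc _ ≤ exp (-(2 * G s)) * ((exp (2 * G s) - 1) / 2 * ‖f‖) := by
          gcongr; exact hest f s hs
      _ = (exp (-(2 * G s)) * exp (2 * G s) - exp (-(2 * G s))) / 2 * ‖f‖ := by ring
      _ ≤ 1 / 2 * ‖f‖ := by
          rw [hmul]; gcongr; linarith [exp_pos (-(2 * G s))]
  have hPd : ∀ f : BoundedContinuousFunction ℝ E, ∀ s,
      HasDerivAt (fun s => x₀ + ∫ r in (0:ℝ)..s, exp (2 * G r) • B r (f r))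
        (exp (2 * G s) • B s (f s)) s := fun f s =>
    ((hFc f).integral_hasStrictDerivAt 0 s).hasDerivAt.const_add x₀
  have hPc : ∀ f : BoundedContinuousFunction ℝ E,
      Continuous (fun s => x₀ + ∫ r in (0:ℝ)..s, exp (2 * G r) • B r (f r)) := fun f =>
    continuous_iff_continuousAt.2 fun s => (hPd f s).continuousAt
  let Φ : BoundedContinuousFunction ℝ E → BoundedContinuousFunction ℝ E := fun f =>
    BoundedContinuousFunction.ofNormedAddCommGroup
      (fun s => exp (-(2 * G (max s 0))) •
        (x₀ + ∫ r in (0:ℝ)..(max s 0), exp (2 * G r) • B r (f r)))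
      ((by fun_prop : Continuous fun s => exp (-(2 * G (max s 0)))).smul
        ((hPc f).comp (by fun_prop : Continuous fun s : ℝ => max s 0)))
      (‖x₀‖ + 1 / 2 * ‖f‖)
      (by
        intro s
        rw [smul_add]
        refine (norm_add_le _ _).trans (add_le_add ?_ (hhalf f _ (le_max_right _ _)))
        rw [norm_smul, norm_of_nonneg (exp_pos _).le]
        exact mul_le_of_le_one_left (norm_nonneg _) (hone _ (le_max_right _ _)))
  have hΦ : ∀ f s, Φ f s = exp (-(2 * G (max s 0))) •
        (x₀ + ∫ r in (0:ℝ)..(max s 0), exp (2 * G r) • B r (f r)) := fun f s => rfl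
  have hcontr : ContractingWith (1 / 2) Φ := by
    refine ⟨by norm_num, LipschitzWith.of_dist_le_mul fun f g => ?_⟩
    refine (BoundedContinuousFunction.dist_le (by positivity)).2 fun s => ?_
    rw [dist_eq_norm, dist_eq_norm, hΦ, hΦ, ← smul_sub, add_sub_add_left_eq_sub,
      ← intervalIntegral.integral_sub ((hFc f).intervalIntegrable _ _)
        ((hFc g).intervalIntegrable _ _)]
    have := hhalf (f - g) (max s 0) (le_max_right _ _)
    simpa [smul_sub] using this
  set v := hcontr.fixedPoint Φ
  have hv : Φ v = v := hcontr.fixedPoint_isFixedPt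
  refine ⟨fun s => x₀ + ∫ r in (0:ℝ)..s, exp (2 * G r) • B r (v r), by simp, fun s hs => ?_⟩
  convert hPd v s using 1
  have h1 : v s = exp (-(2 * G s)) • (x₀ + ∫ r in (0:ℝ)..s, exp (2 * G r) • B r (v r)) := by
    conv_lhs => rw [← hv, hΦ, max_eq_left hs]
  rw [← map_smul]
  congr 1
  conv_rhs => rw [h1]
  rw [smul_smul, mul_comm, hmul, one_smul]

/-- Grönwall's inequality with initial data prescribed as a limit at the left end point. -/
theorem norm_le_of_tendsto_of_norm_deriv_le {E : Type*} [NormedAddCommGroup E] [NormedSpace ℝ E]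
    {u u' : ℝ → E} {x₀ : E} {K T : ℝ} (hT : 0 < T)
    (hu : ∀ s, 0 < s → s ≤ T → HasDerivAt u (u' s) s)
    (hK : ∀ s, 0 < s → s ≤ T → ‖u' s‖ ≤ K * ‖u s‖)
    (hlim : Tendsto u (𝓝[>] 0) (𝓝 x₀)) :
    ‖u T‖ ≤ ‖x₀‖ * exp (K * T) := by
  have h1 : Tendsto (fun ε : ℝ => ‖u ε‖ * exp (K * (T - ε))) (𝓝[>] 0)
      (𝓝 (‖x₀‖ * exp (K * (T - 0)))) := by
    refine hlim.norm.mul ?_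
    exact ((by fun_prop : Continuous fun ε : ℝ => exp (K * (T - ε))).tendsto 0).mono_left
      nhdsWithin_le_nhds
  rw [sub_zero] at h1
  refine ge_of_tendsto h1 ?_
  filter_upwards [Ioc_mem_nhdsGT hT] with ε hε
  have := norm_le_gronwallBound_of_norm_deriv_right_le (f := u) (f' := u') (K := K) (ε := 0)
    (a := ε) (b := T) (δ := ‖u ε‖)
    (fun s hs => (hu s (hε.1.trans_le hs.1) hs.2).continuousAt.continuousWithinAt)
    (fun s hs => (hu s (hε.1.trans_le hs.1) hs.2.le).hasDerivWithinAt) le_rfl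
    (fun s hs => by simpa using hK s (hε.1.trans_le hs.1) hs.2.le) T ⟨hε.2, le_rfl⟩
  rwa [gronwallBound_ε0] at this

/-- High-frequency energy estimate for the oscillator `φ'' = -τ² φ` with exponentially growing,
slowly varying frequency. -/
theorem oscillator_energy_le {φ ψ τ τ₁ τ₂ : ℝ → ℝ} {M δ y₀ y₁ : ℝ} (hδ : 0 < δ)
    (hM : 0 ≤ M) (hy : y₀ ≤ y₁)
    (hφ : ∀ y, HasDerivAt φ (ψ y) y) (hψ : ∀ y, HasDerivAt ψ (-(τ y ^ 2) * φ y) y)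
    (hτ : ∀ y, HasDerivAt τ (τ₁ y) y) (hτ₁ : ∀ y, HasDerivAt τ₁ (τ₂ y) y)
    (hb₁ : ∀ y, |τ₁ y| ≤ M * τ y) (hb₂ : ∀ y, |τ₂ y| ≤ M * τ y)
    (hpos : ∀ y, 0 < τ y) (hgrow : ∀ y, y₀ ≤ y → exp (δ * (y - y₀)) ≤ τ y) (h₀ : τ y₀ = 1) :
    τ y₁ * φ y₁ ^ 2 + ψ y₁ ^ 2 / τ y₁ ≤
      2 * (1 + M + M ^ 2) * exp ((M + 2 * M ^ 2 + 2 * M ^ 3 + 2 * M ^ 2) / δ) *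
        (φ y₀ ^ 2 + ψ y₀ ^ 2) := by
  set K := M + 2 * M ^ 2 + 2 * M ^ 3 + 2 * M ^ 2 with hK
  have hK0 : 0 ≤ K := by positivity
  set E : ℝ → ℝ := fun y => τ y * φ y ^ 2 + (τ y)⁻¹ * ψ y ^ 2
    + τ₁ y * (τ y)⁻¹ ^ 2 * (φ y * ψ y) + M ^ 2 * ((τ y)⁻¹ * φ y ^ 2) with hE
  set E' : ℝ → ℝ := fun y => (τ₂ y * (τ y)⁻¹ ^ 2 - 2 * τ₁ y ^ 2 * (τ y)⁻¹ ^ 3) * (φ y * ψ y)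
    - M ^ 2 * τ₁ y * (τ y)⁻¹ ^ 2 * φ y ^ 2 + 2 * M ^ 2 * (τ y)⁻¹ * (φ y * ψ y) with hE'
  have hEd : ∀ y, HasDerivAt E (E' y) y := by
    intro y
    have hq : HasDerivAt (fun y => (τ y)⁻¹) (-τ₁ y / τ y ^ 2) y := (hτ y).fun_inv (hpos y).ne'
    have := (((hτ y).fun_mul ((hφ y).fun_pow 2)).fun_add (hq.fun_mul ((hψ y).fun_pow 2))).fun_add
      ((((hτ₁ y).fun_mul (hq.fun_pow 2)).fun_mul ((hφ y).fun_mul (hψ y)))) |>.fun_add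
      ((hq.fun_mul ((hφ y).fun_pow 2)).const_mul (M ^ 2))
    refine this.congr_deriv ?_
    have := (hpos y).ne'
    simp only [hE', Nat.cast_ofNat, Nat.add_one_sub_one, pow_one]
    field_simp
    ring
  have hlow : ∀ y, τ y * φ y ^ 2 + (τ y)⁻¹ * ψ y ^ 2 ≤ 2 * E y := by
    intro y
    have hp := hpos y
    have hq : 0 < (τ y)⁻¹ := inv_pos.2 hp
    have h1 : |τ₁ y * (τ y)⁻¹| ≤ M := by
      rw [abs_mul, abs_of_pos hq, ← div_eq_mul_inv, div_le_iff₀ hp]; exact hb₁ y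
    have h2 : (τ₁ y * (τ y)⁻¹) ^ 2 ≤ M ^ 2 := sq_le_sq' (abs_le.1 h1).1 (abs_le.1 h1).2
    have h3 : 2 * E y - (τ y * φ y ^ 2 + (τ y)⁻¹ * ψ y ^ 2) = τ y * φ y ^ 2
        + (τ y)⁻¹ * ((ψ y + (τ₁ y * (τ y)⁻¹) * φ y) ^ 2
        + (2 * M ^ 2 - (τ₁ y * (τ y)⁻¹) ^ 2) * φ y ^ 2) := by
      simp only [hE]; ring
    have h4 : 0 ≤ 2 * M ^ 2 - (τ₁ y * (τ y)⁻¹) ^ 2 := by nlinarith [sq_nonneg M]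
    have : 0 ≤ τ y * φ y ^ 2
        + (τ y)⁻¹ * ((ψ y + (τ₁ y * (τ y)⁻¹) * φ y) ^ 2
        + (2 * M ^ 2 - (τ₁ y * (τ y)⁻¹) ^ 2) * φ y ^ 2) := by positivity
    linarith
  have hup : ∀ y, y₀ ≤ y → E' y ≤ K * exp (-(δ * (y - y₀))) * E y := by
    intro y hy
    have hp := hpos y
    have hg := hgrow y hy
    have hq : 0 < (τ y)⁻¹ := inv_pos.2 hp
    have hqτ : (τ y)⁻¹ * τ y = 1 := inv_mul_cancel₀ hp.ne'
    have hqe : (τ y)⁻¹ ≤ exp (-(δ * (y - y₀))) := by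
      rw [exp_neg]; exact inv_anti₀ (exp_pos _) hg
    have hq1 : (τ y)⁻¹ ≤ 1 := hqe.trans (by
      rw [exp_le_one_iff]; nlinarith)
    set q := (τ y)⁻¹
    have h1 : |τ₁ y * q| ≤ M := by
      rw [abs_mul, abs_of_pos hq]
      calc _ ≤ M * τ y * q := by gcongr; exact hb₁ y
        _ = M := by rw [mul_assoc, mul_comm (τ y), hqτ, mul_one]
    have h2 : |τ₂ y * q| ≤ M := by
      rw [abs_mul, abs_of_pos hq]
      calc _ ≤ M * τ y * q := by gcongr; exact hb₂ y
        _ = M := by rw [mul_assoc, mul_comm (τ y), hqτ, mul_one]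
    set F := τ y * φ y ^ 2 + q * ψ y ^ 2 with hF
    have hF0 : 0 ≤ F := by positivity
    have h3 : |φ y * ψ y| ≤ F / 2 := by
      have e1 : 0 ≤ q * (τ y * φ y + ψ y) ^ 2 := by positivity
      have e2 : 0 ≤ q * (τ y * φ y - ψ y) ^ 2 := by positivity
      have e3 : q * (τ y * φ y + ψ y) ^ 2 = F + 2 * (φ y * ψ y) := by
        rw [hF]; linear_combination (τ y * φ y ^ 2 + 2 * φ y * ψ y) * hqτ
      have e4 : q * (τ y * φ y - ψ y) ^ 2 = F - 2 * (φ y * ψ y) := by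
        rw [hF]; linear_combination (τ y * φ y ^ 2 - 2 * φ y * ψ y) * hqτ
      rw [abs_le]; constructor <;> linarith
    have h4 : q * φ y ^ 2 ≤ q * F := by
      have : φ y ^ 2 = q * (τ y * φ y ^ 2) := by rw [← mul_assoc, hqτ, one_mul]
      have h5 : τ y * φ y ^ 2 ≤ F := by
        have : 0 ≤ q * ψ y ^ 2 := by positivity
        linarith
      have h6 : q * (τ y * φ y ^ 2) ≤ 1 * F := by gcongr
      rw [one_mul, ← this] at h6
      gcongr
    have hEq : E' y = q * ((τ₂ y * q - 2 * (τ₁ y * q) ^ 2 + 2 * M ^ 2) * (φ y * ψ y))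
        - M ^ 2 * (τ₁ y * q) * (q * φ y ^ 2) := by
      simp only [hE', q]; ring
    have h7 : (τ₁ y * q) ^ 2 ≤ M ^ 2 := sq_le_sq' (abs_le.1 h1).1 (abs_le.1 h1).2
    have h8 : (τ₂ y * q - 2 * (τ₁ y * q) ^ 2 + 2 * M ^ 2) * (φ y * ψ y)
        ≤ (M + 2 * M ^ 2 + 2 * M ^ 2) * (F / 2) := by
      refine (le_abs_self _).trans ?_
      rw [abs_mul]
      have := abs_le.1 h2
      have : |τ₂ y * q - 2 * (τ₁ y * q) ^ 2 + 2 * M ^ 2| ≤ M + 2 * M ^ 2 + 2 * M ^ 2 := by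
        rw [abs_le]
        constructor <;> nlinarith [sq_nonneg (τ₁ y * q), sq_nonneg M]
      gcongr
    have h9 : -(M ^ 2 * (τ₁ y * q) * (q * φ y ^ 2)) ≤ M ^ 2 * M * (q * F) := by
      have : -(τ₁ y * q) ≤ M := by linarith [(abs_le.1 h1).1]
      calc _ = M ^ 2 * (-(τ₁ y * q)) * (q * φ y ^ 2) := by ring
        _ ≤ M ^ 2 * M * (q * φ y ^ 2) := by gcongr
        _ ≤ _ := by gcongr
    have h10 : E' y ≤ K * q * (F / 2) := by
      have := mul_le_mul_of_nonneg_left h8 hq.le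
      rw [hEq, hK]
      linarith
    have h11 : F / 2 ≤ E y := by
      have := hlow y
      linarith
    calc E' y ≤ K * q * (F / 2) := h10
      _ ≤ K * exp (-(δ * (y - y₀))) * E y := by gcongr
  have hanti : AntitoneOn (fun y => E y * exp (K / δ * exp (-(δ * (y - y₀))))) (Set.Icc y₀ y₁) := by
    have hd : ∀ y, HasDerivAt (fun y => E y * exp (K / δ * exp (-(δ * (y - y₀)))))
        ((E' y - K * exp (-(δ * (y - y₀))) * E y) * exp (K / δ * exp (-(δ * (y - y₀))))) y := by
      intro y
      have h1 : HasDerivAt (fun y => -(δ * (y - y₀))) (-(δ * 1)) y :=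
        (((hasDerivAt_id y).sub_const y₀).const_mul δ).fun_neg
      have := (hEd y).fun_mul ((h1.exp.const_mul (K / δ)).exp)
      refine this.congr_deriv ?_
      field_simp
      ring
    refine antitoneOn_of_deriv_nonpos (convex_Icc _ _)
      (fun y _ => (hd y).continuousAt.continuousWithinAt)
      (fun y _ => (hd y).differentiableAt.differentiableWithinAt) fun y hy' => ?_
    rw [interior_Icc] at hy'
    rw [(hd y).deriv]
    exact mul_nonpos_of_nonpos_of_nonneg (by linarith [hup y hy'.1.le]) (exp_pos _).le
  have hfin := hanti (Set.left_mem_Icc.2 hy) (Set.right_mem_Icc.2 hy) hy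
  simp only [sub_self, mul_zero, neg_zero, exp_zero, mul_one] at hfin
  have hE1 : 0 ≤ E y₁ := by
    have := hlow y₁
    have hp := hpos y₁
    have : 0 ≤ τ y₁ * φ y₁ ^ 2 + (τ y₁)⁻¹ * ψ y₁ ^ 2 := by positivity
    linarith
  have h12 : E y₁ ≤ E y₁ * exp (K / δ * exp (-(δ * (y₁ - y₀)))) :=
    le_mul_of_one_le_right hE1 (one_le_exp (by positivity))
  have h13 : E y₀ ≤ (1 + M + M ^ 2) * (φ y₀ ^ 2 + ψ y₀ ^ 2) := by
    have h14 : |τ₁ y₀| ≤ M := by simpa [h₀] using hb₁ y₀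
    have h15 : τ₁ y₀ * (φ y₀ * ψ y₀) ≤ M * (φ y₀ ^ 2 + ψ y₀ ^ 2) := by
      refine (le_abs_self _).trans ?_
      rw [abs_mul]
      have : |φ y₀ * ψ y₀| ≤ φ y₀ ^ 2 + ψ y₀ ^ 2 := by
        rw [abs_le]
        constructor <;> nlinarith [sq_nonneg (φ y₀ + ψ y₀), sq_nonneg (φ y₀ - ψ y₀)]
      gcongr
    simp only [hE, h₀, inv_one, one_mul, one_pow, mul_one]
    nlinarith [mul_nonneg (sq_nonneg M) (sq_nonneg (ψ y₀))]
  calc τ y₁ * φ y₁ ^ 2 + ψ y₁ ^ 2 / τ y₁ = τ y₁ * φ y₁ ^ 2 + (τ y₁)⁻¹ * ψ y₁ ^ 2 := by ring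
    _ ≤ 2 * E y₁ := hlow y₁
    _ ≤ 2 * (E y₀ * exp (K / δ)) := by linarith
    _ ≤ 2 * ((1 + M + M ^ 2) * (φ y₀ ^ 2 + ψ y₀ ^ 2) * exp (K / δ)) := by gcongr
    _ = _ := by ring

theorem tau_sq {D : ℕ} (p : Fin D → ℝ) (lam : Fin D → ℤ) {t : ℝ} (ht : 0 ≤ t) :
    tau p lam t ^ 2 = ∑ i, t ^ (2 - 2 * p i) * (lam i : ℝ) ^ 2 :=
  sq_sqrt (Finset.sum_nonneg fun _ _ => mul_nonneg (rpow_nonneg ht _) (sq_nonneg _))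

/-- The symbol `τ_λ²` in the rescaled time `s = (t / t₀) ^ δ`, divided by `s ^ k`. -/
noncomputable def rescaledSymbol {D : ℕ} (p : Fin D → ℝ) (lam : Fin D → ℤ) (δ t₀ : ℝ) (k : ℕ)
    (s : ℝ) : ℝ :=
  ∑ i, t₀ ^ (2 - 2 * p i) * (lam i : ℝ) ^ 2 * s ^ ((2 - 2 * p i) / δ - k)

/-- The generator of the evolution of `(ψ, φ̃)` in the rescaled time `s = (t / t₀) ^ δ`. -/
noncomputable def renormalizedGenerator {D : ℕ} (p : Fin D → ℝ) (lam : Fin D → ℤ) (δ t₀ s : ℝ) :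
    ℝ × ℝ →L[ℝ] ℝ × ℝ :=
  (-(rescaledSymbol p lam δ t₀ 2 s * (s * log s) / δ ^ 2)) •
      (ContinuousLinearMap.fst ℝ ℝ ℝ).prod 0 +
    (-(rescaledSymbol p lam δ t₀ 1 s / δ)) • (ContinuousLinearMap.snd ℝ ℝ ℝ).prod 0 +
    (rescaledSymbol p lam δ t₀ 3 s * (s * log s) ^ 2 / δ ^ 3) •
      (0 : ℝ × ℝ →L[ℝ] ℝ).prod (ContinuousLinearMap.fst ℝ ℝ ℝ) +
    (rescaledSymbol p lam δ t₀ 2 s * (s * log s) / δ ^ 2) •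
      (0 : ℝ × ℝ →L[ℝ] ℝ).prod (ContinuousLinearMap.snd ℝ ℝ ℝ)

section Mode

variable {D : ℕ} {p : Fin D → ℝ} {lam : Fin D → ℤ} {δ t₀ : ℝ}

theorem renormalizedGenerator_apply (s : ℝ) (x : ℝ × ℝ) :
    renormalizedGenerator p lam δ t₀ s x =
      (-(rescaledSymbol p lam δ t₀ 2 s * (s * log s) / δ ^ 2) * x.1 +
          -(rescaledSymbol p lam δ t₀ 1 s / δ) * x.2,
        rescaledSymbol p lam δ t₀ 3 s * (s * log s) ^ 2 / δ ^ 3 * x.1 +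
          rescaledSymbol p lam δ t₀ 2 s * (s * log s) / δ ^ 2 * x.2) := by
  simp [renormalizedGenerator]

theorem continuous_rescaledSymbol (hδ : 0 < δ) (hp : ∀ i, 3 * δ ≤ 2 - 2 * p i) {k : ℕ}
    (hk : k ≤ 3) : Continuous (rescaledSymbol p lam δ t₀ k) := by
  refine continuous_finsetSum _ fun i _ => continuous_const.mul (continuous_rpow_const ?_)
  have h3 : (3 : ℝ) ≤ (2 - 2 * p i) / δ := by rw [le_div_iff₀ hδ]; exact hp i
  have : (k : ℝ) ≤ 3 := by exact_mod_cast hk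
  linarith

theorem continuous_renormalizedGenerator (hδ : 0 < δ) (hp : ∀ i, 3 * δ ≤ 2 - 2 * p i) :
    Continuous (renormalizedGenerator p lam δ t₀) := by
  have h1 := continuous_rescaledSymbol (lam := lam) (t₀ := t₀) hδ hp (k := 1) (by norm_num)
  have h2 := continuous_rescaledSymbol (lam := lam) (t₀ := t₀) hδ hp (k := 2) (by norm_num)
  have h3 := continuous_rescaledSymbol (lam := lam) (t₀ := t₀) hδ hp (k := 3) (by norm_num)
  have h4 := continuous_mul_log
  unfold renormalizedGenerator
  fun_prop

theorem rescaledSymbol_mul_pow (ht₀ : 0 < t₀) (k : ℕ) {s : ℝ} (hs : 0 < s) :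
    rescaledSymbol p lam δ t₀ k s * s ^ k = tau p lam (t₀ * s ^ (1 / δ)) ^ 2 := by
  rw [tau_sq _ _ (by positivity), rescaledSymbol, Finset.sum_mul]
  refine Finset.sum_congr rfl fun i _ => ?_
  rw [mul_rpow ht₀.le (by positivity), ← rpow_mul hs.le, rpow_sub_natCast hs.ne',
    one_div_mul_eq_div]
  field_simp

theorem rescaledSymbol_mem_Icc (ht₀ : 0 < t₀) (hτ : tau p lam t₀ = 1) (hδ : 0 < δ)
    (hp : ∀ i, 3 * δ ≤ 2 - 2 * p i) {k : ℕ} (hk : k ≤ 3) {s : ℝ} (hs : 0 < s) (hs1 : s ≤ 1) :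
    rescaledSymbol p lam δ t₀ k s ∈ Set.Icc 0 1 := by
  constructor
  · exact Finset.sum_nonneg fun i _ => by positivity
  · have h1 : (1 : ℝ) = ∑ i, t₀ ^ (2 - 2 * p i) * (lam i : ℝ) ^ 2 := by
      rw [← tau_sq _ _ ht₀.le, hτ, one_pow]
    rw [h1]
    refine Finset.sum_le_sum fun i _ => mul_le_of_le_one_right (by positivity) ?_
    refine rpow_le_one hs.le hs1 ?_
    have h3 : (3 : ℝ) ≤ (2 - 2 * p i) / δ := by rw [le_div_iff₀ hδ]; exact hp i
    have : (k : ℝ) ≤ 3 := by exact_mod_cast hk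
    linarith

theorem norm_renormalizedGenerator_apply_le (ht₀ : 0 < t₀) (hτ : tau p lam t₀ = 1) (hδ : 0 < δ)
    (hp : ∀ i, 3 * δ ≤ 2 - 2 * p i) {s : ℝ} (hs : 0 < s) (hs1 : s ≤ 1) (x : ℝ × ℝ) :
    ‖renormalizedGenerator p lam δ t₀ s x‖ ≤ (1 / δ + 2 / δ ^ 2 + 1 / δ ^ 3) * ‖x‖ := by
  have hl : |s * log s| ≤ 1 := by rw [mul_comm]; exact (abs_log_mul_self_lt s hs hs1).le
  have hS : ∀ k ≤ 3, |rescaledSymbol p lam δ t₀ k s| ≤ 1 := fun k hk => by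
    have := rescaledSymbol_mem_Icc ht₀ hτ hδ hp hk hs hs1
    rw [abs_of_nonneg this.1]; exact this.2
  have e1 : |rescaledSymbol p lam δ t₀ 1 s / δ| ≤ 1 / δ := by
    rw [abs_div, abs_of_pos hδ]; gcongr; exact hS 1 (by norm_num)
  have e2 : |rescaledSymbol p lam δ t₀ 2 s * (s * log s) / δ ^ 2| ≤ 1 / δ ^ 2 := by
    rw [abs_div, abs_of_pos (pow_pos hδ 2), abs_mul]; gcongr
    exact mul_le_one₀ (hS 2 (by norm_num)) (abs_nonneg _) hl
  have e3 : |rescaledSymbol p lam δ t₀ 3 s * (s * log s) ^ 2 / δ ^ 3| ≤ 1 / δ ^ 3 := by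
    rw [abs_div, abs_of_pos (pow_pos hδ 3), abs_mul, abs_pow]; gcongr
    exact mul_le_one₀ (hS 3 (by norm_num)) (by positivity) (pow_le_one₀ (abs_nonneg _) hl)
  have hx1 : |x.1| ≤ ‖x‖ := norm_fst_le x
  have hx2 : |x.2| ≤ ‖x‖ := norm_snd_le x
  have d1 : 0 < 1 / δ := by positivity
  have d2 : 0 < 1 / δ ^ 2 := by positivity
  have d3 : 0 < 1 / δ ^ 3 := by positivity
  have hsplit : (2 : ℝ) / δ ^ 2 = 1 / δ ^ 2 + 1 / δ ^ 2 := by ring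
  have hx : 0 ≤ ‖x‖ := norm_nonneg x
  rw [renormalizedGenerator_apply, hsplit]
  refine norm_prod_le_iff.2 ⟨?_, ?_⟩
  · refine (abs_add_le _ _).trans ?_
    rw [abs_mul, abs_mul, abs_neg, abs_neg]
    calc _ ≤ 1 / δ ^ 2 * ‖x‖ + 1 / δ * ‖x‖ := by gcongr
      _ ≤ _ := by rw [← add_mul]; exact mul_le_mul_of_nonneg_right (by linarith) hx
  · refine (abs_add_le _ _).trans ?_
    rw [abs_mul, abs_mul]
    calc _ ≤ 1 / δ ^ 3 * ‖x‖ + 1 / δ ^ 2 * ‖x‖ := by gcongr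
      _ ≤ _ := by rw [← add_mul]; exact mul_le_mul_of_nonneg_right (by linarith) hx

theorem tendsto_const_mul_rpow_nhdsGT_zero {c e : ℝ} (hc : 0 < c) (he : 0 < e) :
    Tendsto (fun s : ℝ => c * s ^ e) (𝓝[>] 0) (𝓝[>] 0) := by
  refine tendsto_nhdsWithin_iff.2 ⟨?_, ?_⟩
  · have : Continuous fun s : ℝ => c * s ^ e := continuous_const.mul (continuous_rpow_const he.le)
    simpa [zero_rpow he.ne'] using (this.tendsto 0).mono_left nhdsWithin_le_nhds
  · filter_upwards [self_mem_nhdsWithin] with s hs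
    exact mul_pos hc (rpow_pos_of_pos hs _)

/-- In the rescaled time, `(ψ, φ̃)` solves the renormalized system. -/
theorem IsWaveSol.hasDerivAt_renormalized {φ ψ : ℝ → ℝ} (h : IsWaveSol p lam φ ψ (Set.Ioi 0))
    (hδ : 0 < δ) (ht₀ : 0 < t₀) {s : ℝ} (hs : 0 < s) :
    HasDerivAt (fun s => (ψ (t₀ * s ^ (1 / δ)),
        φ (t₀ * s ^ (1 / δ)) - ψ (t₀ * s ^ (1 / δ)) * (log s / δ)))
      (renormalizedGenerator p lam δ t₀ s (ψ (t₀ * s ^ (1 / δ)),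
        φ (t₀ * s ^ (1 / δ)) - ψ (t₀ * s ^ (1 / δ)) * (log s / δ))) s := by
  set t := t₀ * s ^ (1 / δ) with ht
  have htpos : 0 < t := by positivity
  have hdt : HasDerivAt (fun s : ℝ => t₀ * s ^ (1 / δ)) (t / (δ * s)) s := by
    refine ((hasDerivAt_rpow_const (Or.inl hs.ne')).const_mul t₀).congr_deriv ?_
    rw [rpow_sub_one hs.ne', ht]
    field_simp
  obtain ⟨h1, h2⟩ := h t htpos
  have hψ := HasDerivAt.comp s (by simpa only [← ht] using h2) hdt
  have hφ := HasDerivAt.comp s (by simpa only [← ht] using h1) hdt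
  have := hψ.prodMk (hφ.fun_sub (hψ.fun_mul ((hasDerivAt_log hs.ne').div_const δ)))
  refine this.congr_deriv ?_
  rw [renormalizedGenerator_apply]
  have hS : ∀ k, rescaledSymbol p lam δ t₀ k s = tau p lam t ^ 2 / s ^ k := fun k => by
    rw [ht, ← rescaledSymbol_mul_pow ht₀ k hs]; field_simp
  simp only [hS, Function.comp_apply, ← ht]
  ext
  · simp only
    field_simp
    ring
  · simp only
    field_simp
    ring

/-- Solutions of the renormalized system yield wave solutions. -/
theorem isWaveSol_of_hasDerivAt_renormalized {u : ℝ → ℝ × ℝ} (hδ : 0 < δ) (ht₀ : 0 < t₀)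
    (hu : ∀ s, 0 < s → HasDerivAt u (renormalizedGenerator p lam δ t₀ s (u s)) s) :
    IsWaveSol p lam
      (fun t => (u ((t / t₀) ^ δ)).2 + (u ((t / t₀) ^ δ)).1 * log (t / t₀))
      (fun t => (u ((t / t₀) ^ δ)).1) (Set.Ioi 0) := by
  intro t ht
  have ht : 0 < t := ht
  have hr : 0 < t / t₀ := by positivity
  set s := (t / t₀) ^ δ with hs
  have hspos : 0 < s := by positivity
  have hts : t = t₀ * s ^ (1 / δ) := by
    rw [hs, ← rpow_mul hr.le, mul_one_div_cancel hδ.ne', rpow_one]; field_simp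
  have hlog : log s = δ * log (t / t₀) := by rw [hs, log_rpow hr]
  have hds : HasDerivAt (fun t : ℝ => (t / t₀) ^ δ) (δ * s / t) t := by
    refine (((hasDerivAt_id t).div_const t₀).rpow_const (Or.inl hr.ne')).congr_deriv ?_
    simp only [id]
    rw [rpow_sub_one hr.ne', ← hs]
    field_simp
  have hl : HasDerivAt (fun t : ℝ => log (t / t₀)) (1 / t) t := by
    refine (((hasDerivAt_id t).div_const t₀).log hr.ne').congr_deriv ?_
    simp only [id]
    field_simp
  have hus := hu s hspos
  have h1 : HasDerivAt (fun t => (u ((t / t₀) ^ δ)).1) _ t :=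
    HasDerivAt.comp t (h₂ := fun s => (u s).1) (hasFDerivAt_fst.comp_hasDerivAt s hus) hds
  have h2 : HasDerivAt (fun t => (u ((t / t₀) ^ δ)).2) _ t :=
    HasDerivAt.comp t (h₂ := fun s => (u s).2) (hasFDerivAt_snd.comp_hasDerivAt s hus) hds
  have hS : ∀ k, rescaledSymbol p lam δ t₀ k s = tau p lam t ^ 2 / s ^ k := fun k => by
    rw [hts, ← rescaledSymbol_mul_pow ht₀ k hspos]; field_simp
  refine ⟨(h2.fun_add (h1.fun_mul hl)).congr_deriv ?_, h1.congr_deriv ?_⟩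
  · simp only [renormalizedGenerator_apply, hS, hlog, ContinuousLinearMap.coe_fst',
      ContinuousLinearMap.coe_snd', ← hs]
    field_simp
    ring
  · simp only [renormalizedGenerator_apply, hS, hlog, ContinuousLinearMap.coe_fst', ← hs]
    field_simp
    ring

theorem tendsto_renormalized {φ ψ : ℝ → ℝ} {a b : ℝ} (hδ : 0 < δ) (ht₀ : 0 < t₀)
    (ha : Tendsto ψ (𝓝[>] 0) (𝓝 a))
    (hb : Tendsto (fun t => φ t - ψ t * log (t / t₀)) (𝓝[>] 0) (𝓝 b)) :
    Tendsto (fun s => (ψ (t₀ * s ^ (1 / δ)),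
        φ (t₀ * s ^ (1 / δ)) - ψ (t₀ * s ^ (1 / δ)) * (log s / δ))) (𝓝[>] 0) (𝓝 (a, b)) := by
  have h := tendsto_const_mul_rpow_nhdsGT_zero ht₀ (one_div_pos.2 hδ)
  refine (ha.comp h).prodMk_nhds ((hb.comp h).congr' ?_)
  filter_upwards [self_mem_nhdsWithin] with s hs
  have hs : 0 < s := hs
  rw [Function.comp_apply, mul_div_cancel_left₀ _ ht₀.ne', log_rpow hs, one_div_mul_eq_div]

/-- Wave solutions are determined by their asymptotic data. -/
theorem IsWaveSol.eq_of_tendsto {φ ψ φ' ψ' : ℝ → ℝ} {a b : ℝ}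
    (hδ : 0 < δ) (hp : ∀ i, 3 * δ ≤ 2 - 2 * p i) (ht₀ : 0 < t₀)
    (h : IsWaveSol p lam φ ψ (Set.Ioi 0)) (ha : Tendsto ψ (𝓝[>] 0) (𝓝 a))
    (hb : Tendsto (fun t => φ t - ψ t * log (t / t₀)) (𝓝[>] 0) (𝓝 b))
    (h' : IsWaveSol p lam φ' ψ' (Set.Ioi 0)) (ha' : Tendsto ψ' (𝓝[>] 0) (𝓝 a))
    (hb' : Tendsto (fun t => φ' t - ψ' t * log (t / t₀)) (𝓝[>] 0) (𝓝 b)) {t : ℝ} (ht : 0 < t) :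
    φ' t = φ t ∧ ψ' t = ψ t := by
  have htt : 0 < t / t₀ := by positivity
  set T := (t / t₀) ^ δ with hT
  have hTpos : 0 < T := by positivity
  have htT : t₀ * T ^ (1 / δ) = t := by
    rw [hT, ← rpow_mul htt.le, mul_one_div_cancel hδ.ne', rpow_one]; field_simp
  obtain ⟨K, hK⟩ := isCompact_Icc.exists_bound_of_continuousOn (s := Set.Icc 0 T)
    (continuous_renormalizedGenerator (lam := lam) (t₀ := t₀) hδ hp).continuousOn
  have := norm_le_of_tendsto_of_norm_deriv_le (x₀ := 0) (K := K) hTpos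
    (fun s hs _ => (h'.hasDerivAt_renormalized hδ ht₀ hs).fun_sub
      (h.hasDerivAt_renormalized hδ ht₀ hs))
    (fun s hs hsT => by
      rw [← map_sub]
      exact (renormalizedGenerator p lam δ t₀ s).le_of_opNorm_le (hK s ⟨hs.le, hsT⟩) _)
    (by
      have h0 := (tendsto_renormalized hδ ht₀ ha' hb').sub (tendsto_renormalized hδ ht₀ ha hb)
      simpa using h0)
  simp only [norm_zero, zero_mul, norm_le_zero_iff, htT, Prod.mk_sub_mk, Prod.mk_eq_zero] at this
  have e : ψ' t = ψ t := sub_eq_zero.1 this.1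
  refine ⟨?_, e⟩
  rw [e] at this
  linarith [this.2]

/-- Wave solutions with prescribed asymptotic data exist. -/
theorem exists_isWaveSol_tendsto (hδ : 0 < δ) (hp : ∀ i, 3 * δ ≤ 2 - 2 * p i) (ht₀ : 0 < t₀)
    (a b : ℝ) :
    ∃ φ ψ : ℝ → ℝ, IsWaveSol p lam φ ψ (Set.Ioi 0) ∧ Tendsto ψ (𝓝[>] 0) (𝓝 a) ∧
      Tendsto (fun t => φ t - ψ t * log (t / t₀)) (𝓝[>] 0) (𝓝 b) := by
  obtain ⟨u, hu0, hu⟩ := exists_forall_hasDerivAt_linear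
    (continuous_renormalizedGenerator (lam := lam) (t₀ := t₀) hδ hp) (a, b)
  have hlim : Tendsto (fun t : ℝ => u ((t / t₀) ^ δ)) (𝓝[>] 0) (𝓝 (a, b)) := by
    have h1 : Tendsto (fun t : ℝ => (t / t₀) ^ δ) (𝓝[>] 0) (𝓝 0) := by
      have h2 : Continuous fun t : ℝ => (t / t₀) ^ δ :=
        (continuous_rpow_const hδ.le).comp (continuous_id.div_const t₀)
      simpa [zero_rpow hδ.ne'] using (h2.tendsto 0).mono_left nhdsWithin_le_nhds
    have h3 := (hu 0 le_rfl).continuousAt.tendsto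
    rw [hu0] at h3
    exact h3.comp h1
  refine ⟨_, _, isWaveSol_of_hasDerivAt_renormalized hδ ht₀ fun s hs => hu s hs.le,
    (continuous_fst.tendsto _).comp hlim, ?_⟩
  simp only [add_sub_cancel_right]
  exact (continuous_snd.tendsto _).comp hlim

/-- Low-frequency energy estimate, from the asymptotic data up to the transition time. -/
theorem IsWaveSol.sq_add_sq_le {φ ψ : ℝ → ℝ} {a b : ℝ}
    (hδ : 0 < δ) (hp : ∀ i, 3 * δ ≤ 2 - 2 * p i) (ht₀ : 0 < t₀) (hτ : tau p lam t₀ = 1)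
    (h : IsWaveSol p lam φ ψ (Set.Ioi 0)) (ha : Tendsto ψ (𝓝[>] 0) (𝓝 a))
    (hb : Tendsto (fun t => φ t - ψ t * log (t / t₀)) (𝓝[>] 0) (𝓝 b)) :
    φ t₀ ^ 2 + ψ t₀ ^ 2 ≤ 2 * exp (1 / δ + 2 / δ ^ 2 + 1 / δ ^ 3) ^ 2 * (a ^ 2 + b ^ 2) := by
  have := norm_le_of_tendsto_of_norm_deriv_le zero_lt_one
    (fun s hs _ => h.hasDerivAt_renormalized hδ ht₀ hs)
    (fun s hs hs1 => norm_renormalizedGenerator_apply_le ht₀ hτ hδ hp hs hs1 _)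
    (tendsto_renormalized hδ ht₀ ha hb)
  simp only [one_rpow, mul_one, log_one, zero_div, mul_zero, sub_zero] at this
  set A := exp (1 / δ + 2 / δ ^ 2 + 1 / δ ^ 3)
  have hab : ‖(a, b)‖ ^ 2 ≤ a ^ 2 + b ^ 2 := by
    rw [Prod.norm_def]
    rcases max_cases ‖(a, b).1‖ ‖(a, b).2‖ with h | h <;> rw [h.1] <;> simp <;> positivity
  have h1 : ψ t₀ ^ 2 ≤ (‖(a, b)‖ * A) ^ 2 :=
    sq_le_sq.2 (((norm_fst_le (ψ t₀, φ t₀)).trans this).trans (le_abs_self _))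
  have h2 : φ t₀ ^ 2 ≤ (‖(a, b)‖ * A) ^ 2 :=
    sq_le_sq.2 (((norm_snd_le (ψ t₀, φ t₀)).trans this).trans (le_abs_self _))
  calc φ t₀ ^ 2 + ψ t₀ ^ 2 ≤ 2 * A ^ 2 * ‖(a, b)‖ ^ 2 := by
        rw [mul_pow] at h1 h2; linarith
    _ ≤ _ := by gcongr

/-- High-frequency energy estimate, from the transition time up to time one. -/
theorem IsWaveSol.energy_one_le {φ ψ : ℝ → ℝ} {c : ℝ} (hδ : 0 < δ)
    (hp : ∀ i, 3 * δ ≤ 2 - 2 * p i) (hc : ∀ i, 2 - 2 * p i ≤ c) (hc0 : 0 ≤ c)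
    (ht₀ : 0 < t₀) (ht₁ : t₀ ≤ 1) (hτ : tau p lam t₀ = 1)
    (h : IsWaveSol p lam φ ψ (Set.Ioi 0)) {M : ℝ} (hM : M = c ^ 2 + c) :
    tau p lam 1 * φ 1 ^ 2 + ψ 1 ^ 2 / tau p lam 1 ≤
      2 * (1 + M + M ^ 2) * exp ((M + 2 * M ^ 2 + 2 * M ^ 3 + 2 * M ^ 2) / δ) *
        (φ t₀ ^ 2 + ψ t₀ ^ 2) := by
  have hci : ∀ i, 0 ≤ 2 - 2 * p i := fun i => by linarith [hp i]
  let W : ℕ → ℝ → ℝ := fun k y =>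
    ∑ i, (2 - 2 * p i) ^ k * (exp ((2 - 2 * p i) * y) * (lam i : ℝ) ^ 2)
  have hWd : ∀ k y, HasDerivAt (W k) (W (k + 1) y) y := by
    intro k y
    refine HasDerivAt.fun_sum fun i _ => ?_
    have h1 : HasDerivAt (fun y => (2 - 2 * p i) * y) ((2 - 2 * p i) * 1) y :=
      (hasDerivAt_id y).const_mul _
    refine ((h1.exp.mul_const _).const_mul _).congr_deriv ?_
    ring
  have hWnonneg : ∀ k y, 0 ≤ W k y := fun k y => Finset.sum_nonneg fun i _ =>
    mul_nonneg (pow_nonneg (hci i) _) (by positivity)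
  have hWle : ∀ k y, W (k + 1) y ≤ c * W k y := by
    intro k y
    simp only [W]
    rw [Finset.mul_sum]
    refine Finset.sum_le_sum fun i _ => ?_
    rw [pow_succ, mul_right_comm, mul_comm c]
    exact mul_le_mul_of_nonneg_left (hc i) (mul_nonneg (pow_nonneg (hci i) _) (by positivity))
  have hτW : ∀ y, tau p lam (exp y) ^ 2 = W 0 y := by
    intro y
    rw [tau_sq _ _ (exp_pos y).le]
    refine Finset.sum_congr rfl fun i _ => ?_
    rw [← exp_mul, mul_comm y, pow_zero, one_mul]
  have hW₀ : W 0 (log t₀) = 1 := by rw [← hτW, exp_log ht₀, hτ, one_pow]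
  have hWpos : ∀ y, 0 < W 0 y := by
    intro y
    obtain ⟨i, -, hi⟩ : ∃ i ∈ Finset.univ, (2 - 2 * p i) ^ 0 *
        (exp ((2 - 2 * p i) * log t₀) * (lam i : ℝ) ^ 2) ≠ 0 := by
      refine Finset.exists_ne_zero_of_sum_ne_zero ?_
      have : W 0 (log t₀) ≠ 0 := by rw [hW₀]; exact one_ne_zero
      exact this
    have hli : (lam i : ℝ) ≠ 0 := by rintro h0; simp [h0] at hi
    refine Finset.sum_pos' (fun i _ => by positivity) ⟨i, Finset.mem_univ i, by positivity⟩
  set τ : ℝ → ℝ := fun y => tau p lam (exp y) with hτdef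
  have hτsqrt : τ = fun y => √(W 0 y) := by
    ext y
    rw [← hτW]
    exact (sqrt_sq (sqrt_nonneg _)).symm
  have hτpos : ∀ y, 0 < τ y := fun y => by rw [hτsqrt]; exact sqrt_pos.2 (hWpos y)
  have hτd : ∀ y, HasDerivAt τ (W 1 y / (2 * τ y)) y := by
    intro y
    rw [hτsqrt]
    exact (hWd 0 y).sqrt (hWpos y).ne'
  have hτ₁b : ∀ y, W 1 y / (2 * τ y) ≤ c / 2 * τ y := by
    intro y
    have := hτpos y
    rw [div_le_iff₀ (by positivity)]
    calc _ ≤ c * W 0 y := hWle 0 y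
      _ = _ := by rw [← hτW]; ring
  have hτ₁0 : ∀ y, 0 ≤ W 1 y / (2 * τ y) := fun y =>
    div_nonneg (hWnonneg _ _) (by linarith [hτpos y])
  have key := oscillator_energy_le (φ := fun y => φ (exp y)) (ψ := fun y => ψ (exp y)) (τ := τ)
    (τ₁ := fun y => W 1 y / (2 * τ y))
    (τ₂ := fun y => W 2 y / (2 * τ y) - W 1 y / (2 * τ y) * (W 1 y / (2 * τ y)) / τ y)
    (M := M) (y₀ := log t₀) (y₁ := 0) hδ (by rw [hM]; positivity)
    (log_nonpos ht₀.le ht₁)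
    (fun y => by
      refine ((h (exp y) (exp_pos y)).1.comp y (hasDerivAt_exp y)).congr_deriv ?_
      field_simp)
    (fun y => by
      refine ((h (exp y) (exp_pos y)).2.comp y (hasDerivAt_exp y)).congr_deriv ?_
      simp only [hτdef]
      field_simp)
    hτd
    (fun y => by
      have := (hτpos y).ne'
      refine ((hWd 1 y).fun_div ((hτd y).const_mul 2) (by positivity)).congr_deriv ?_
      field_simp)
    (fun y => by
      rw [abs_of_nonneg (hτ₁0 y)]
      refine (hτ₁b y).trans ?_
      have := (hτpos y).le
      gcongr
      nlinarith)
    (fun y => by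
      have := hτpos y
      have h1 : 0 ≤ W 2 y / (2 * τ y) := div_nonneg (hWnonneg _ _) (by positivity)
      have h2 : W 2 y / (2 * τ y) ≤ c ^ 2 / 2 * τ y := by
        rw [div_le_iff₀ (by positivity)]
        calc _ ≤ c * (c * W 0 y) := (hWle 1 y).trans (by gcongr; exact hWle 0 y)
          _ = _ := by rw [← hτW]; ring
      have h3 : W 1 y / (2 * τ y) * (W 1 y / (2 * τ y)) / τ y ≤ c ^ 2 / 4 * τ y := by
        rw [div_le_iff₀ this]
        calc _ ≤ (c / 2 * τ y) * (c / 2 * τ y) :=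
              mul_le_mul (hτ₁b y) (hτ₁b y) (hτ₁0 y) (by positivity)
          _ = _ := by ring
      have h4 : 0 ≤ W 1 y / (2 * τ y) * (W 1 y / (2 * τ y)) / τ y :=
        div_nonneg (mul_nonneg (hτ₁0 y) (hτ₁0 y)) this.le
      have h5 : 0 ≤ c ^ 2 * τ y := by positivity
      have h6 : 0 ≤ c * τ y := by positivity
      rw [abs_le, hM]
      constructor <;> linarith)
    hτpos
    (fun y hy => by
      rw [hτsqrt]
      refine le_sqrt_of_sq_le ?_
      rw [← mul_one (_ ^ 2), ← hW₀, Finset.mul_sum]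
      refine Finset.sum_le_sum fun i _ => ?_
      have : exp (δ * (y - log t₀)) ^ 2 * exp ((2 - 2 * p i) * log t₀)
          ≤ exp ((2 - 2 * p i) * y) := by
        rw [← exp_nat_mul, ← exp_add, exp_le_exp]
        have := mul_nonneg (by linarith [hp i] : 0 ≤ 2 - 2 * p i - 2 * δ) (sub_nonneg.2 hy)
        push_cast
        linarith
      rw [pow_zero, one_mul, one_mul, ← mul_assoc]
      gcongr)
    (by simp only [hτdef, exp_log ht₀, hτ])
  simpa only [hτdef, exp_zero, exp_log ht₀] using key

end Mode

theorem jap_pos {D : ℕ} (lam : Fin D → ℤ) : 0 < jap lam :=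
  sqrt_pos.2 (by positivity)

theorem jap_sq_eq_one_add_tau_sq {D : ℕ} (p : Fin D → ℝ) (lam : Fin D → ℤ) :
    jap lam ^ 2 = 1 + tau p lam 1 ^ 2 := by
  rw [tau_sq _ _ zero_le_one, jap, sq_sqrt (by positivity)]
  simp

theorem one_le_tau_one {D : ℕ} (p : Fin D → ℝ) {lam : Fin D → ℤ} (h : lam ≠ 0) :
    1 ≤ tau p lam 1 := by
  obtain ⟨i, hi⟩ := Function.ne_iff.1 h
  refine one_le_sqrt.2 ?_
  simp only [one_rpow, one_mul]
  refine le_trans ?_ (Finset.single_le_sum (f := fun i => (lam i : ℝ) ^ 2)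
    (fun i _ => sq_nonneg _) (Finset.mem_univ i))
  have : 1 ≤ |lam i| := Int.one_le_abs hi
  have h2 : (1 : ℝ) ≤ |(lam i : ℝ)| := by exact_mod_cast this
  simpa using one_le_pow₀ (n := 2) h2

theorem exists_pos_forall_le_of_forall_pos {ι : Type*} [Finite ι] {c : ι → ℝ}
    (hc : ∀ i, 0 < c i) : ∃ ε > 0, ∀ i, ε ≤ c i := by
  cases isEmpty_or_nonempty ι
  · exact ⟨1, one_pos, fun i => isEmptyElim i⟩
  · obtain ⟨i, hi⟩ := Finite.exists_min c
    exact ⟨c i, hc i, hi⟩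

/-- Asymptotic completeness bound with half-derivative loss: asymptotic data in
H^{s+1/2} × H^{s+1/2} launches a unique solution whose Cauchy data at t = 1 lies in
H^{s+1} × H^s, with a bound uniform in s. -/
theorem wave_asymptotic_completeness_bound (D : ℕ) (hD : 2 ≤ D) (p : Fin D → ℝ)
    (hp : ∀ i, p i < 1) :
    ∃ C : ℝ, 0 < C ∧
      ∀ (s : ℝ) (tstar : (Fin D → ℤ) → ℝ),
      (∀ lam : Fin D → ℤ, lam ≠ 0 →
        0 < tstar lam ∧ tstar lam ≤ 1 ∧ tau p lam (tstar lam) = 1) →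
      ∀ (a b : (Fin D → ℤ) → ℝ),
      Summable (fun l : {l : Fin D → ℤ // l ≠ 0} =>
        jap l.1 ^ (2 * s + 1) * ((a l.1) ^ 2 + (b l.1) ^ 2)) →
      ∃ φ ψ : (Fin D → ℤ) → ℝ → ℝ,
        (∀ lam : Fin D → ℤ, lam ≠ 0 →
          IsWaveSol p lam (φ lam) (ψ lam) (Set.Ioi 0) ∧
          Tendsto (ψ lam) (𝓝[>] (0:ℝ)) (𝓝 (a lam)) ∧
          Tendsto (fun t => φ lam t - ψ lam t * Real.log (t / tstar lam))
            (𝓝[>] (0:ℝ)) (𝓝 (b lam)) ∧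
          (∀ φ' ψ' : ℝ → ℝ, IsWaveSol p lam φ' ψ' (Set.Ioi 0) →
            Tendsto ψ' (𝓝[>] (0:ℝ)) (𝓝 (a lam)) →
            Tendsto (fun t => φ' t - ψ' t * Real.log (t / tstar lam))
              (𝓝[>] (0:ℝ)) (𝓝 (b lam)) →
            ∀ t : ℝ, 0 < t → φ' t = φ lam t ∧ ψ' t = ψ lam t)) ∧
        Summable (fun l : {l : Fin D → ℤ // l ≠ 0} =>
          jap l.1 ^ (2 * s + 2) * (φ l.1 1) ^ 2 + jap l.1 ^ (2 * s) * (ψ l.1 1) ^ 2) ∧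
        (∑' l : {l : Fin D → ℤ // l ≠ 0},
            (jap l.1 ^ (2 * s + 2) * (φ l.1 1) ^ 2 + jap l.1 ^ (2 * s) * (ψ l.1 1) ^ 2)) ≤
          C * ∑' l : {l : Fin D → ℤ // l ≠ 0},
            jap l.1 ^ (2 * s + 1) * ((a l.1) ^ 2 + (b l.1) ^ 2) := by
  obtain ⟨ε, hε, hεp⟩ := exists_pos_forall_le_of_forall_pos (c := fun i => 2 - 2 * p i)
    fun i => by linarith [hp i]
  obtain ⟨c, hc⟩ := Finite.exists_le fun i => 2 - 2 * p i
  obtain ⟨δ, hδ, hδp⟩ : ∃ δ > 0, ∀ i, 3 * δ ≤ 2 - 2 * p i :=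
    ⟨ε / 3, by positivity, fun i => by linarith [hεp i]⟩
  have hc0 : 0 ≤ c := by
    have := hc ⟨0, by omega⟩
    have := hp ⟨0, by omega⟩
    linarith
  obtain ⟨M, hM⟩ : ∃ M, M = c ^ 2 + c := ⟨_, rfl⟩
  have hM0 : 0 ≤ M := by rw [hM]; positivity
  set A := 2 * (1 + M + M ^ 2) * exp ((M + 2 * M ^ 2 + 2 * M ^ 3 + 2 * M ^ 2) / δ) with hA
  set A' := 2 * exp (1 / δ + 2 / δ ^ 2 + 1 / δ ^ 3) ^ 2 with hA'
  have hA0 : 0 ≤ A := by positivity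
  refine ⟨2 * (A * A'), by positivity, fun s tstar hstar a b hsum => ?_⟩
  have hex : ∀ lam : Fin D → ℤ, ∃ φ ψ : ℝ → ℝ, lam ≠ 0 →
      IsWaveSol p lam φ ψ (Set.Ioi 0) ∧ Tendsto ψ (𝓝[>] (0:ℝ)) (𝓝 (a lam)) ∧
      Tendsto (fun t => φ t - ψ t * Real.log (t / tstar lam)) (𝓝[>] (0:ℝ)) (𝓝 (b lam)) := by
    intro lam
    by_cases h : lam = 0
    · exact ⟨0, 0, fun h' => absurd h h'⟩
    · obtain ⟨φ, ψ, hsol⟩ := exists_isWaveSol_tendsto (lam := lam) hδ hδp (hstar lam h).1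
        (a lam) (b lam)
      exact ⟨φ, ψ, fun _ => hsol⟩
  choose φ ψ hsol using hex
  have hmode : ∀ l : {l : Fin D → ℤ // l ≠ 0},
      jap l.1 ^ (2 * s + 2) * (φ l.1 1) ^ 2 + jap l.1 ^ (2 * s) * (ψ l.1 1) ^ 2 ≤
        2 * (A * A') * (jap l.1 ^ (2 * s + 1) * ((a l.1) ^ 2 + (b l.1) ^ 2)) := by
    rintro ⟨l, hl⟩
    obtain ⟨h1, h2, h3⟩ := hsol l hl
    obtain ⟨ht0, ht1, hτ⟩ := hstar l hl
    have hlow := h1.sq_add_sq_le hδ hδp ht0 hτ h2 h3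
    have hhigh := h1.energy_one_le hδ hδp hc hc0 ht0 ht1 hτ hM
    rw [← hA] at hhigh
    rw [← hA'] at hlow
    have hT := one_le_tau_one p hl
    have hJ := jap_sq_eq_one_add_tau_sq p l
    have hJ0 := jap_pos l
    set T := tau p l 1
    set J := jap l
    have hTJ : T ≤ J := abs_le_of_sq_le_sq' (by linarith) hJ0.le |>.2
    have hen : T * φ l 1 ^ 2 + ψ l 1 ^ 2 / T ≤ A * A' * (a l ^ 2 + b l ^ 2) := by
      exact (hhigh.trans (mul_le_mul_of_nonneg_left hlow hA0)).trans_eq (mul_assoc A A' _).symm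
    have hT0 : 0 < T := by linarith
    have hmain : J ^ 2 * φ l 1 ^ 2 + ψ l 1 ^ 2 ≤ J * (2 * (A * A') * (a l ^ 2 + b l ^ 2)) := by
      have hJ2 : J ^ 2 ≤ 2 * T ^ 2 := by nlinarith
      calc J ^ 2 * φ l 1 ^ 2 + ψ l 1 ^ 2 ≤ 2 * T ^ 2 * φ l 1 ^ 2 + 2 * ψ l 1 ^ 2 := by
            have : J ^ 2 * φ l 1 ^ 2 ≤ 2 * T ^ 2 * φ l 1 ^ 2 := by gcongr
            linarith [sq_nonneg (ψ l 1)]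
        _ = T * (2 * (T * φ l 1 ^ 2 + ψ l 1 ^ 2 / T)) := by field_simp
        _ ≤ J * (2 * (A * A' * (a l ^ 2 + b l ^ 2))) := by gcongr
        _ = _ := by ring
    have := mul_le_mul_of_nonneg_left hmain (rpow_nonneg hJ0.le (2 * s))
    have e2 : J ^ (2 * s + 2) = J ^ (2 * s) * J ^ 2 := by
      rw [rpow_add hJ0]; norm_num
    have e1 : J ^ (2 * s + 1) = J ^ (2 * s) * J := rpow_add_one hJ0.ne' _
    change J ^ (2 * s + 2) * φ l 1 ^ 2 + J ^ (2 * s) * ψ l 1 ^ 2 ≤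
      2 * (A * A') * (J ^ (2 * s + 1) * (a l ^ 2 + b l ^ 2))
    rw [e1, e2]
    linarith
  have hsummable : Summable fun l : {l : Fin D → ℤ // l ≠ 0} =>
      jap l.1 ^ (2 * s + 2) * (φ l.1 1) ^ 2 + jap l.1 ^ (2 * s) * (ψ l.1 1) ^ 2 := by
    refine Summable.of_nonneg_of_le (fun l => ?_) hmode (hsum.mul_left _)
    have := jap_pos l.1
    positivity
  refine ⟨φ, ψ, fun lam hl => ?_, hsummable, ?_⟩
  · obtain ⟨h1, h2, h3⟩ := hsol lam hl
    exact ⟨h1, h2, h3, fun φ' ψ' h1' h2' h3' t ht =>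
      h1.eq_of_tendsto hδ hδp (hstar lam hl).1 h2 h3 h1' h2' h3' ht⟩
  · rw [← tsum_mul_left]
    exact hsummable.tsum_le_tsum hmode (hsum.mul_left _)
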